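/- Let k be a positive integer. A graph G is not b-χ-k-bounded if and only if G contains an induced subgraph that is a minimal χ-k-unbounded b-atom. -/

import Mathlib

noncomputable section

open Function

/-- A proper coloring of `G` with colors in `Fin k`. -/
def IsProperColoring {V : Type} (G : SimpleGraph V) {k : ℕ} (c : V → Fin k) : Prop :=
  ∀ u v : V, G.Adj u v → c u ≠ c v

/-- A b-`k`-coloring: a surjective proper coloring in which every color class
contains a b-vertex. -/
def IsBColoring {V : Type} (G : SimpleGraph V) {k : ℕ} (c : V → Fin k) : Prop :=
  Function.Surjective c ∧ IsProperColoring G c ∧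
    ∀ i : Fin k, ∃ v : V, c v = i ∧ ∀ j : Fin k, j ≠ i → ∃ u : V, G.Adj v u ∧ c u = j

def HasBColoring {V : Type} (G : SimpleGraph V) (k : ℕ) : Prop :=
  ∃ c : V → Fin k, IsBColoring G c

/-- The b-chromatic number `φ(G)`. -/
def bChromatic {V : Type} [Fintype V] (G : SimpleGraph V) : ℕ :=
  sSup {k | HasBColoring G k}

/-- The b-relaxed number `φ_r(G)`: the maximum of `φ(H)` over induced subgraphs `H`. -/
def bRelaxed {V : Type} [Fintype V] (G : SimpleGraph V) : ℕ :=
  sSup {k | ∃ s : Finset V, bChromatic (G.induce (↑s : Set V)) = k}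

/-- A partial Grundy `k`-coloring: a surjective proper coloring in which every
color class contains a Grundy vertex. -/
def IsPartialGrundyColoring {V : Type} (G : SimpleGraph V) {k : ℕ} (c : V → Fin k) : Prop :=
  Function.Surjective c ∧ IsProperColoring G c ∧
    ∀ i : Fin k, ∃ v : V, c v = i ∧ ∀ j : Fin k, j < i → ∃ u : V, G.Adj v u ∧ c u = j

/-- The partial Grundy number `∂Γ(G)`. -/
def partialGrundy {V : Type} [Fintype V] (G : SimpleGraph V) : ℕ :=
  sSup {k | ∃ c : V → Fin k, IsPartialGrundyColoring G c}

/-- A pG-`t`-atom structure on a graph `A`. -/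
def IsPGAtom {V : Type} (A : SimpleGraph V) (t : ℕ) : Prop :=
  ∃ (D : Fin t → Finset V) (c : Fin t → V),
    (∀ v : V, ∃! i : Fin t, v ∈ D i) ∧
    (∀ i : Fin t, c i ∈ D i) ∧
    (∀ i : Fin t, ∀ u ∈ D i, ∀ v ∈ D i, ¬ A.Adj u v) ∧
    (∀ i : Fin t, (D i).card ≤ t - (i : ℕ)) ∧
    (∀ i j : Fin t, j < i → ∃ v ∈ D j, A.Adj (c i) v)

/-- A minimal pG-`t`-atom: no proper induced subgraph is a pG-`t`-atom. -/
def IsMinPGAtom {V : Type} [Fintype V] (A : SimpleGraph V) (t : ℕ) : Prop :=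
  IsPGAtom A t ∧
    ∀ s : Finset V, s ≠ Finset.univ → ¬ IsPGAtom (A.induce (↑s : Set V)) t

/-- A b-`t`-atom structure on a graph `A`. -/
def IsBAtom {V : Type} (A : SimpleGraph V) (t : ℕ) : Prop :=
  ∃ (D : Fin t → Finset V) (c : Fin t → V),
    (∀ v : V, ∃! i : Fin t, v ∈ D i) ∧
    (∀ i : Fin t, c i ∈ D i) ∧
    (∀ i : Fin t, ∀ u ∈ D i, ∀ v ∈ D i, ¬ A.Adj u v) ∧
    (∀ i : Fin t, (D i).card ≤ t) ∧
    (∀ i j : Fin t, i ≠ j → ∃ v ∈ D j, A.Adj (c i) v)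

/-- A minimal b-`t`-atom: no proper induced subgraph is a b-`t`-atom. -/
def IsMinBAtom {V : Type} [Fintype V] (A : SimpleGraph V) (t : ℕ) : Prop :=
  IsBAtom A t ∧
    ∀ s : Finset V, s ≠ Finset.univ → ¬ IsBAtom (A.induce (↑s : Set V)) t

/-- `V(A) ∪ N(A)` for the induced subgraph of `G` on `s`. -/
def closedNbhdSet {V : Type} (G : SimpleGraph V) (s : Set V) : Set V :=
  s ∪ {v : V | v ∉ s ∧ ∃ u ∈ s, G.Adj u v}

/-- The induced subgraph of `G` on `s` is feasible (as a b-`t`-atom) in `G`: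
some b-`t`-coloring of it extends to a proper coloring of the induced subgraph
on `V(A) ∪ N(A)` using only the `t` colors. -/
def IsFeasibleIn {V : Type} (G : SimpleGraph V) (s : Finset V) (t : ℕ) : Prop :=
  ∃ c : V → Fin t,
    IsBColoring (G.induce (↑s : Set V)) (fun v => c v.1) ∧
    ∀ u v : V, u ∈ closedNbhdSet G (↑s : Set V) → v ∈ closedNbhdSet G (↑s : Set V) →
      G.Adj u v → c u ≠ c v

/-- A b-`t`-trap vertex: an induced b-`t`-atom avoiding `v`, not feasible in `G`
but feasible in `G - v`. -/
def IsVertexBTrap {V : Type} [Fintype V] [DecidableEq V] (G : SimpleGraph V) (v : V)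
    (t : ℕ) : Prop :=
  ∃ s : Finset V, v ∉ s ∧ IsBAtom (G.induce (↑s : Set V)) t ∧ ¬ IsFeasibleIn G s t ∧
    IsFeasibleIn (G.induce {u : V | u ≠ v}) (s.subtype (fun u => u ≠ v)) t

/-- A b-`t`-trap edge: an induced b-`t`-atom, not feasible in `G`
but feasible in `G - e`. -/
def IsEdgeBTrap {V : Type} (G : SimpleGraph V) (e : Sym2 V) (t : ℕ) : Prop :=
  ∃ s : Finset V, IsBAtom (G.induce (↑s : Set V)) t ∧ ¬ IsFeasibleIn G s t ∧
    IsFeasibleIn (G.deleteEdges {e}) s t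

/-- The chromatic number as a natural number (least `k` admitting a surjective
proper `k`-coloring). -/
def chromaticNum {V : Type} [Fintype V] (G : SimpleGraph V) : ℕ :=
  sInf {k | ∃ c : V → Fin k, Function.Surjective c ∧ IsProperColoring G c}

/-- `G` is b-χ-`k`-bounded: `φ(G') - χ(G') ≤ k` for every induced subgraph `G'`. -/
def IsBChiBounded {V : Type} [Fintype V] (G : SimpleGraph V) (k : ℕ) : Prop :=
  ∀ s : Finset V,
    bChromatic (G.induce (↑s : Set V)) - chromaticNum (G.induce (↑s : Set V)) ≤ k

/-- A χ-`k`-unbounded b-atom: a b-`t`-atom (for some positive `t`) with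
`φ(G) - χ(G) > k`. -/
def IsChiUnboundedBAtom {V : Type} [Fintype V] (A : SimpleGraph V) (k : ℕ) : Prop :=
  k < bChromatic A - chromaticNum A ∧ ∃ t : ℕ, 1 ≤ t ∧ IsBAtom A t

/-- A minimal χ-`k`-unbounded b-atom. -/
def IsMinChiUnboundedBAtom {V : Type} [Fintype V] (A : SimpleGraph V) (k : ℕ) : Prop :=
  IsChiUnboundedBAtom A k ∧
    ∀ s : Finset V, s ≠ Finset.univ → ¬ IsChiUnboundedBAtom (A.induce (↑s : Set V)) k

end

theorem IsBColoring.comp_iso {V W : Type} {G : SimpleGraph V} {H : SimpleGraph W} (e : G ≃g H)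
    {k : ℕ} {c : W → Fin k} (h : IsBColoring H c) : IsBColoring G (c ∘ e) := by
  obtain ⟨hs, hp, hb⟩ := h
  refine ⟨hs.comp e.surjective, fun u v huv => hp _ _ (e.map_adj_iff.2 huv), fun i => ?_⟩
  obtain ⟨v, hv, hv'⟩ := hb i
  refine ⟨e.symm v, by simpa using hv, fun j hj => ?_⟩
  obtain ⟨u, hu, huj⟩ := hv' j hj
  exact ⟨e.symm u, e.symm.map_adj_iff.2 hu, by simpa using huj⟩

theorem hasBColoring_congr {V W : Type} {G : SimpleGraph V} {H : SimpleGraph W} (e : G ≃g H)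
    (k : ℕ) : HasBColoring G k ↔ HasBColoring H k :=
  ⟨fun ⟨_, h⟩ => ⟨_, h.comp_iso e.symm⟩, fun ⟨_, h⟩ => ⟨_, h.comp_iso e⟩⟩

theorem bChromatic_congr {V W : Type} [Fintype V] [Fintype W] {G : SimpleGraph V}
    {H : SimpleGraph W} (e : G ≃g H) : bChromatic G = bChromatic H := by
  simp only [bChromatic, hasBColoring_congr e]

theorem IsBAtom.of_iso {V W : Type} {G : SimpleGraph V} {H : SimpleGraph W} (e : G ≃g H)
    {t : ℕ} (h : IsBAtom G t) : IsBAtom H t := by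
  obtain ⟨D, c, hpart, hc, hind, hcard, hadj⟩ := h
  have hmem (i : Fin t) (w : W) :
      w ∈ (D i).map e.toEquiv.toEmbedding ↔ e.symm w ∈ D i := by
    rw [Finset.mem_map_equiv]; rfl
  refine ⟨fun i => (D i).map e.toEquiv.toEmbedding, fun i => e (c i), fun w => ?_, fun i => ?_,
    fun i u hu v hv huv => ?_, fun i => ?_, fun i j hij => ?_⟩
  · simpa only [hmem] using hpart (e.symm w)
  · exact (hmem _ _).2 (by rw [e.symm_apply_apply]; exact hc i)
  · rw [hmem] at hu hv
    exact hind i _ hu _ hv (e.symm.map_adj_iff.2 huv)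
  · simpa using hcard i
  · obtain ⟨v, hv, hcv⟩ := hadj i j hij
    exact ⟨e v, (hmem _ _).2 (by rw [e.symm_apply_apply]; exact hv), e.map_adj_iff.2 hcv⟩

theorem bddAbove_hasBColoring {V : Type} [Fintype V] (G : SimpleGraph V) :
    BddAbove {k | HasBColoring G k} :=
  ⟨Fintype.card V, fun _ ⟨_, h⟩ => by simpa using Fintype.card_le_of_surjective _ h.1⟩

theorem exists_surjective_proper_chromaticNum {V : Type} [Fintype V] (G : SimpleGraph V) :
    ∃ c : V → Fin (chromaticNum G), Function.Surjective c ∧ IsProperColoring G c := by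
  refine Nat.sInf_mem (s := {k | ∃ c : V → Fin k, Function.Surjective c ∧ IsProperColoring G c}) ?_
  exact ⟨Fintype.card V, Fintype.equivFin V, (Fintype.equivFin V).surjective,
    fun u v huv h => huv.ne ((Fintype.equivFin V).injective h)⟩

theorem chromaticNum_le_of_isProperColoring {V : Type} [Fintype V] {G : SimpleGraph V} {m : ℕ}
    {c : V → Fin m} (h : IsProperColoring G c) : chromaticNum G ≤ m := by
  classical
  let e := Fintype.equivFin (Set.range c)
  have hle : Fintype.card (Set.range c) ≤ m := by
    exact (Fintype.card_subtype_le (· ∈ Set.range c)).trans_eq (Fintype.card_fin m)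
  refine le_trans (Nat.sInf_le ?_) hle
  refine ⟨fun v => e ⟨c v, v, rfl⟩, fun i => ?_, fun u v huv huv' => ?_⟩
  · obtain ⟨⟨_, v, rfl⟩, hv⟩ := e.surjective i
    exact ⟨v, hv⟩
  · exact h u v huv (congrArg Subtype.val (e.injective huv'))

theorem chromaticNum_le_of_hom {V W : Type} [Fintype V] [Fintype W] {G : SimpleGraph V}
    {H : SimpleGraph W} (f : G →g H) : chromaticNum G ≤ chromaticNum H := by
  obtain ⟨c, -, hc⟩ := exists_surjective_proper_chromaticNum H
  exact chromaticNum_le_of_isProperColoring (c := c ∘ f) fun u v huv => hc _ _ (f.map_adj huv)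

theorem IsChiUnboundedBAtom.of_iso {V W : Type} [Fintype V] [Fintype W] {G : SimpleGraph V}
    {H : SimpleGraph W} (e : G ≃g H) {k : ℕ} (h : IsChiUnboundedBAtom G k) :
    IsChiUnboundedBAtom H k := by
  obtain ⟨hk, t, ht, hA⟩ := h
  have hφ := bChromatic_congr e
  have hχ := chromaticNum_le_of_hom e.symm.toHom
  exact ⟨by omega, t, ht, hA.of_iso e⟩

/-- An induced subgraph of an induced subgraph of `G` is an induced subgraph of `G`. -/
def induceInduceIso {V : Type} (G : SimpleGraph V) (s : Set V) (u : Finset s) :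
    (G.induce s).induce (↑u : Set s) ≃g
      G.induce (↑(u.map (Function.Embedding.subtype (· ∈ s))) : Set V) where
  toFun x := ⟨x.1.1, by simp⟩
  invFun y := ⟨⟨y.1, by have := y.2; simp at this; exact this.1⟩,
    by have := y.2; simp at this; exact this.2⟩
  left_inv _ := rfl
  right_inv _ := rfl
  map_rel_iff' := Iff.rfl

/-- The b-vertices of a b-`t`-coloring, with one neighbor of each other color for each of them,
induce a b-`t`-atom on which the coloring is still a b-`t`-coloring. -/
theorem IsBColoring.exists_induce_isBAtom {V : Type} {G : SimpleGraph V} {t : ℕ}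
    {c : V → Fin t} (h : IsBColoring G c) :
    ∃ s : Finset V, HasBColoring (G.induce (↑s : Set V)) t ∧
      IsBAtom (G.induce (↑s : Set V)) t := by
  classical
  obtain ⟨-, hp, hb⟩ := h
  choose b hbc hb using hb
  have hnbr : ∀ i j, ∃ u, c u = j ∧ (i = j → u = b i) ∧ (i ≠ j → G.Adj (b i) u) := by
    intro i j
    by_cases hij : i = j
    · exact ⟨b i, by rw [hbc, hij], fun _ => rfl, fun h => absurd hij h⟩
    · obtain ⟨u, hu, huj⟩ := hb i j (Ne.symm hij)
      exact ⟨u, huj, fun h => absurd h hij, fun _ => hu⟩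
  choose n hnc hnb hna using hnbr
  let s : Finset V := Finset.univ.image fun p : Fin t × Fin t => n p.1 p.2
  have hns (i j) : n i j ∈ s := Finset.mem_image.2 ⟨(i, j), Finset.mem_univ _, rfl⟩
  have hbs (i) : b i ∈ s := hnb i i rfl ▸ hns i i
  refine ⟨s, ⟨fun x => c x.1, fun i => ⟨⟨b i, hbs i⟩, hbc i⟩, fun u v huv => hp _ _ huv,
    fun i => ⟨⟨b i, hbs i⟩, hbc i, fun j hj => ⟨⟨n i j, hns i j⟩, hna i j hj.symm, hnc i j⟩⟩⟩,
    fun i => Finset.univ.filter fun x => c x.1 = i, fun i => ⟨b i, hbs i⟩, fun v => ?_,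
    fun i => ?_, fun i u hu v hv huv => ?_, fun j => ?_, fun i j hij => ?_⟩
  · exact ⟨c v.1, by simp, fun i hi => (Finset.mem_filter.1 hi).2.symm⟩
  · simpa using hbc i
  · simp only [Finset.mem_filter, Finset.mem_univ, true_and] at hu hv
    exact hp _ _ huv (hu.trans hv.symm)
  · have hsub : (Finset.univ.filter fun x : (↑s : Set V) => c x.1 = j).map
        (Function.Embedding.subtype _) ⊆ Finset.univ.image fun i => n i j := by
      intro v hv
      obtain ⟨⟨v, hvs⟩, hx, rfl⟩ := Finset.mem_map.1 hv
      obtain ⟨⟨i, j'⟩, -, rfl⟩ := Finset.mem_image.1 (Finset.mem_coe.1 hvs)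
      obtain rfl : j' = j := by simpa [hnc] using hx
      exact Finset.mem_image.2 ⟨i, Finset.mem_univ _, rfl⟩
    simpa using (Finset.card_le_card hsub).trans Finset.card_image_le
  · exact ⟨⟨n i j, hns i j⟩, by simpa using hnc i j, hna i j hij⟩

theorem exists_induce_isChiUnboundedBAtom {V : Type} [Fintype V] {G : SimpleGraph V} {k : ℕ}
    (h : k < bChromatic G - chromaticNum G) :
    ∃ s : Finset V, IsChiUnboundedBAtom (G.induce (↑s : Set V)) k := by
  have hne : {m | HasBColoring G m}.Nonempty := by
    by_contra hne
    have : bChromatic G = 0 := by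
      rw [bChromatic, Set.not_nonempty_iff_eq_empty.1 hne]; simp
    omega
  obtain ⟨c, hc⟩ : HasBColoring G (bChromatic G) := Nat.sSup_mem hne (bddAbove_hasBColoring G)
  obtain ⟨s, hcol, hatom⟩ := hc.exists_induce_isBAtom
  have hφ : bChromatic G ≤ bChromatic (G.induce (↑s : Set V)) :=
    le_csSup (bddAbove_hasBColoring _) hcol
  have hχ := chromaticNum_le_of_hom (SimpleGraph.Embedding.induce (G := G) (↑s : Set V)).toHom
  exact ⟨s, by omega, bChromatic G, by omega, hatom⟩

/-- G is not b-χ-k-bounded iff G contains an induced minimal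
χ-k-unbounded b-atom. -/
theorem not_bChiBounded_iff {V : Type} [Fintype V] (G : SimpleGraph V) (k : ℕ)
    (hk : 1 ≤ k) :
    ¬ IsBChiBounded G k ↔
      ∃ s : Finset V, IsMinChiUnboundedBAtom (G.induce (↑s : Set V)) k := by
  constructor
  · intro h
    simp only [IsBChiBounded, not_forall, not_le] at h
    obtain ⟨s, hs⟩ := h
    obtain ⟨u, hu⟩ := exists_induce_isChiUnboundedBAtom hs
    obtain ⟨m, hm, hmin⟩ := exists_minimalFor_of_wellFoundedLT
      (fun m : Finset V => IsChiUnboundedBAtom (G.induce (↑m : Set V)) k) Finset.card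
      ⟨_, hu.of_iso (induceInduceIso G _ u)⟩
    refine ⟨m, hm, fun w hw hwk => ?_⟩
    have hle := hmin (hwk.of_iso (induceInduceIso G _ w))
    have hlt := Finset.card_lt_card (Finset.ssubset_univ_iff.2 hw)
    simp only [Finset.card_map, Finset.card_univ, Finset.coe_sort_coe, Fintype.card_coe] at hle hlt
    omega
  · rintro ⟨s, hs⟩ h
    exact (h s).not_gt hs.1.1
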